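/- Let G be a finite simple graph and let uv be an edge of G. Then uv is essential (i.e., contained in a unique maxclique of G) if and only if the set N[u] ∩ N[v] is a clique of G. -/

import Mathlib

/-- A *maxclique* of a graph is an inclusion-maximal clique. -/
def SimpleGraph.IsMaxclique {V : Type*} (G : SimpleGraph V) (C : Set V) : Prop :=
  G.IsClique C ∧ ∀ D : Set V, G.IsClique D → C ⊆ D → D = C

/-- The closed neighborhood `N[v]` of a vertex `v`. -/
def SimpleGraph.closedNbhd {V : Type*} (G : SimpleGraph V) (v : V) : Set V :=
  {u | u = v ∨ G.Adj u v}

theorem SimpleGraph.IsClique.exists_isMaxclique_superset {V : Type*} [Finite V]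
    {G : SimpleGraph V} {K : Set V} (hK : G.IsClique K) :
    ∃ C, K ⊆ C ∧ G.IsMaxclique C := by
  obtain ⟨C, hKC, hC⟩ := Finite.exists_le_maximal (p := fun D : Set V => G.IsClique D) hK
  exact ⟨C, hKC, hC.prop, fun D hD hCD => (hC.le_of_ge hD hCD).antisymm hCD⟩

theorem SimpleGraph.IsClique.subset_closedNbhd {V : Type*} {G : SimpleGraph V} {K : Set V}
    (hK : G.IsClique K) {v : V} (hv : v ∈ K) : K ⊆ G.closedNbhd v := fun _ hx =>
  or_iff_not_imp_left.2 fun h => hK hx hv h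

theorem SimpleGraph.isClique_insert_pair_of_mem_closedNbhd {V : Type*} {G : SimpleGraph V}
    {u v x : V} (huv : G.Adj u v) (hu : x ∈ G.closedNbhd u) (hv : x ∈ G.closedNbhd v) :
    G.IsClique {x, u, v} := by
  refine (SimpleGraph.isClique_pair.2 fun _ => huv).insert ?_
  rintro b (rfl | rfl) hb
  · exact hu.resolve_left hb
  · exact hv.resolve_left hb

/-- An edge `uv` is *essential* (contained in a unique maxclique) iff
`N[u] ∩ N[v]` is a clique. -/
theorem stmt14 {V : Type*} [Fintype V] (G : SimpleGraph V) (u v : V) (huv : G.Adj u v) :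
    (∃! C : Set V, G.IsMaxclique C ∧ u ∈ C ∧ v ∈ C) ↔
      G.IsClique (G.closedNbhd u ∩ G.closedNbhd v) := by
  constructor
  · rintro ⟨C, ⟨hC, -, -⟩, huniq⟩
    have hsub : G.closedNbhd u ∩ G.closedNbhd v ⊆ C := by
      rintro x ⟨hxu, hxv⟩
      obtain ⟨D, hD, hDmax⟩ :=
        (SimpleGraph.isClique_insert_pair_of_mem_closedNbhd huv hxu hxv).exists_isMaxclique_superset
      have hDC : D = C := huniq D ⟨hDmax, hD (by simp), hD (by simp)⟩
      exact hDC ▸ hD (by simp)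
    exact hC.1.subset hsub
  · intro hN
    have hsub {D : Set V} (hD : G.IsClique D) (hu : u ∈ D) (hv : v ∈ D) :
        D ⊆ G.closedNbhd u ∩ G.closedNbhd v :=
      Set.subset_inter (hD.subset_closedNbhd hu) (hD.subset_closedNbhd hv)
    have hu : u ∈ G.closedNbhd u ∩ G.closedNbhd v := ⟨Or.inl rfl, Or.inr huv⟩
    have hv : v ∈ G.closedNbhd u ∩ G.closedNbhd v := ⟨Or.inr huv.symm, Or.inl rfl⟩
    refine ⟨_, ⟨⟨hN, fun D hD hle => (hsub hD (hle hu) (hle hv)).antisymm hle⟩, hu, hv⟩, ?_⟩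
    rintro D ⟨hD, huD, hvD⟩
    exact (hD.2 _ hN (hsub hD.1 huD hvD)).symm
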